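/- Let X be a Polish space. Then for a generic non-empty compact set K ⊆ X, either K is finite or there exists a continuous gauge function h such that 0 < H^h(K) < ∞ and, for every weak contraction f : K → X, H^h(K ∩ f(K)) = 0. -/

import Mathlib

open MeasureTheory Filter Set TopologicalSpace

/-- A gauge function: non-decreasing, right-continuous, vanishing exactly at `0`. -/
def IsGauge (h : ENNReal → ENNReal) : Prop :=
  Monotone h ∧ (∀ x, h x = 0 ↔ x = 0) ∧
    ∀ x : ENNReal, Tendsto h (nhdsWithin x (Set.Ioi x)) (nhds (h x))

/-- A continuous gauge function: a gauge function continuous on `[0, ∞)`. -/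
def IsContinuousGauge (h : ENNReal → ENNReal) : Prop :=
  IsGauge h ∧ ContinuousOn h {x : ENNReal | x ≠ ⊤}

/-- A continuous cut-off function, `0` up to `2ρ` and `1` from `3ρ` on. -/
noncomputable def cutoff (ρ : ENNReal) (t : ENNReal) : ℝ := (min 1 ((t - 2 * ρ) / ρ)).toReal

lemma cutoff_continuous {ρ : ENNReal} (h0 : ρ ≠ 0) : Continuous (cutoff ρ) := by
  have h1 : Continuous fun t : ENNReal => min 1 ((t - 2 * ρ) / ρ) := by
    refine continuous_const.min ?_
    simp only [div_eq_mul_inv]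
    exact ENNReal.continuous_mul_const (ENNReal.inv_ne_top.2 h0) |>.comp
      (ENNReal.continuous_sub_right _)
  exact ENNReal.continuousOn_toReal.comp_continuous h1
    (fun t => ne_top_of_le_ne_top ENNReal.one_ne_top (min_le_left _ _))

lemma cutoff_mono (ρ : ENNReal) : Monotone (cutoff ρ) := by
  intro a b hab
  refine ENNReal.toReal_mono (ne_top_of_le_ne_top ENNReal.one_ne_top (min_le_left _ _)) ?_
  gcongr

lemma cutoff_nonneg (ρ t : ENNReal) : 0 ≤ cutoff ρ t := ENNReal.toReal_nonneg

lemma cutoff_le_one (ρ t : ENNReal) : cutoff ρ t ≤ 1 := by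
  have := ENNReal.toReal_mono ENNReal.one_ne_top (min_le_left 1 ((t - 2 * ρ) / ρ))
  simpa [cutoff] using this

lemma cutoff_eq_zero {ρ t : ENNReal} (h : t ≤ 2 * ρ) : cutoff ρ t = 0 := by
  simp [cutoff, tsub_eq_zero_of_le h]

lemma cutoff_eq_one {ρ t : ENNReal} (h0 : ρ ≠ 0) (h1 : ρ ≠ ⊤) (h : 3 * ρ ≤ t) :
    cutoff ρ t = 1 := by
  have : 1 ≤ (t - 2 * ρ) / ρ := by
    rw [ENNReal.le_div_iff_mul_le (Or.inl h0) (Or.inl h1), one_mul]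
    refine ENNReal.le_sub_of_add_le_left (ENNReal.mul_ne_top (by simp) h1) ?_
    calc 2 * ρ + ρ = 3 * ρ := by ring
      _ ≤ t := h
  simp [cutoff, min_eq_left this]

/-- The real-valued gauge attached to radii `r` and cardinalities `N`. -/
noncomputable def realGauge (r : ℕ → ℝ) (N : ℕ → ℕ) (t : ENNReal) : ℝ :=
  ∑' n, ((N n : ℝ)⁻¹ * cutoff (ENNReal.ofReal (r (n + 1))) t)

/-- The gauge attached to radii `r` and cardinalities `N`. -/
noncomputable def theGauge (r : ℕ → ℝ) (N : ℕ → ℕ) (t : ENNReal) : ENNReal :=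
  ENNReal.ofReal (realGauge r N t)

section gauge

variable {r : ℕ → ℝ} {N : ℕ → ℕ}

lemma N_tail (hN0 : 0 < N 0) (hN : ∀ n, 2 * N n ≤ N (n + 1)) (n m : ℕ) :
    0 < N n ∧ ((N (n + m) : ℝ))⁻¹ ≤ (N n : ℝ)⁻¹ * (1 / 2) ^ m := by
  have hpos : ∀ n, 0 < N n := by
    intro n
    induction n with
    | zero => exact hN0
    | succ k ih => have := hN k; omega
  refine ⟨hpos n, ?_⟩
  have h2 : 2 ^ m * N n ≤ N (n + m) := by
    induction m with
    | zero => simp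
    | succ k ih =>
      have := hN (n + k)
      calc 2 ^ (k + 1) * N n = 2 * (2 ^ k * N n) := by ring
        _ ≤ 2 * N (n + k) := by omega
        _ ≤ _ := this
  have h3 : (2 : ℝ) ^ m * N n ≤ N (n + m) := by exact_mod_cast h2
  have h4 : (0 : ℝ) < N n := by exact_mod_cast hpos n
  rw [one_div, inv_pow, ← mul_inv]
  apply inv_anti₀ (by positivity)
  linarith

lemma term_le (hN0 : 0 < N 0) (hN : ∀ n, 2 * N n ≤ N (n + 1)) (n : ℕ) (t : ENNReal) :
    ‖(N n : ℝ)⁻¹ * cutoff (ENNReal.ofReal (r (n + 1))) t‖ ≤ (N 0 : ℝ)⁻¹ * (1 / 2) ^ n := by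
  have h := (N_tail hN0 hN 0 n).2
  rw [zero_add] at h
  rw [Real.norm_of_nonneg (mul_nonneg (by positivity) (cutoff_nonneg _ _))]
  refine le_trans (mul_le_of_le_one_right (by positivity) (cutoff_le_one _ _)) h

lemma summ_geo (c : ℝ) : Summable fun n : ℕ => c * (1 / 2 : ℝ) ^ n :=
  (summable_geometric_of_lt_one (by norm_num) (by norm_num)).mul_left _

lemma summ_term (hN0 : 0 < N 0) (hN : ∀ n, 2 * N n ≤ N (n + 1)) (t : ENNReal) :
    Summable fun n => (N n : ℝ)⁻¹ * cutoff (ENNReal.ofReal (r (n + 1))) t :=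
  Summable.of_norm_bounded (summ_geo _) (fun n => term_le hN0 hN n t)

lemma realGauge_continuous (hr0 : ∀ n, 0 < r n) (hN0 : 0 < N 0)
    (hN : ∀ n, 2 * N n ≤ N (n + 1)) : Continuous (realGauge r N) := by
  refine continuous_tsum (fun n => continuous_const.mul (cutoff_continuous ?_)) (summ_geo _)
    (fun n t => term_le hN0 hN n t)
  simpa using hr0 (n + 1)

lemma realGauge_mono (hN0 : 0 < N 0)
    (hN : ∀ n, 2 * N n ≤ N (n + 1)) : Monotone (realGauge r N) := by
  intro a b hab
  refine Summable.tsum_le_tsum (fun n => ?_) (summ_term hN0 hN a) (summ_term hN0 hN b)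
  exact mul_le_mul_of_nonneg_left (cutoff_mono _ hab) (by positivity)

lemma realGauge_lower (hr0 : ∀ n, 0 < r n) (hN0 : 0 < N 0)
    (hN : ∀ n, 2 * N n ≤ N (n + 1)) (n : ℕ) {t : ENNReal}
    (ht : 3 * ENNReal.ofReal (r (n + 1)) ≤ t) : (N n : ℝ)⁻¹ ≤ realGauge r N t := by
  have := (summ_term (r := r) hN0 hN t).le_tsum n
    (fun j _ => mul_nonneg (by positivity) (cutoff_nonneg _ _))
  rw [cutoff_eq_one (by simpa using hr0 (n + 1)) ENNReal.ofReal_ne_top ht, mul_one] at this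
  exact this

lemma realGauge_upper (hrm : Antitone r) (hN0 : 0 < N 0)
    (hN : ∀ n, 2 * N n ≤ N (n + 1)) (n : ℕ) {t : ENNReal}
    (ht : t ≤ 2 * ENNReal.ofReal (r n)) : realGauge r N t ≤ 2 * (N n : ℝ)⁻¹ := by
  have hs := summ_term (r := r) hN0 hN t
  rw [realGauge, ← hs.sum_add_tsum_nat_add n, Finset.sum_eq_zero, zero_add]
  · have hs' := (summable_nat_add_iff n).2 hs
    refine (hs'.tsum_le_tsum (fun m => ?_) (summ_geo (N n : ℝ)⁻¹)).trans ?_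
    · refine le_trans (mul_le_of_le_one_right (by positivity) (cutoff_le_one _ _)) ?_
      have := (N_tail hN0 hN n m).2
      rwa [add_comm n m] at this
    · rw [tsum_mul_left, tsum_geometric_two, mul_comm]
  · intro m hm
    rw [cutoff_eq_zero, mul_zero]
    refine ht.trans ?_
    gcongr
    exact hrm (by simpa using hm)

lemma theGauge_zero : theGauge r N 0 = 0 := by
  simp [theGauge, realGauge, cutoff_eq_zero]

lemma theGauge_lower (hr0 : ∀ n, 0 < r n) (hN0 : 0 < N 0)
    (hN : ∀ n, 2 * N n ≤ N (n + 1)) (n : ℕ) {t : ENNReal}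
    (ht : 3 * ENNReal.ofReal (r (n + 1)) ≤ t) : (N n : ENNReal)⁻¹ ≤ theGauge r N t := by
  have := ENNReal.ofReal_le_ofReal (realGauge_lower hr0 hN0 hN n ht)
  rwa [ENNReal.ofReal_inv_of_pos (by exact_mod_cast (N_tail hN0 hN n 0).1),
    ENNReal.ofReal_natCast] at this

lemma theGauge_upper (hrm : Antitone r) (hN0 : 0 < N 0)
    (hN : ∀ n, 2 * N n ≤ N (n + 1)) (n : ℕ) {t : ENNReal}
    (ht : t ≤ 2 * ENNReal.ofReal (r n)) : theGauge r N t ≤ 2 * (N n : ENNReal)⁻¹ := by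
  have := ENNReal.ofReal_le_ofReal (realGauge_upper hrm hN0 hN n ht)
  rwa [ENNReal.ofReal_mul (by norm_num),
    ENNReal.ofReal_inv_of_pos (by exact_mod_cast (N_tail hN0 hN n 0).1),
    ENNReal.ofReal_natCast, ENNReal.ofReal_ofNat] at this

lemma theGauge_isContinuousGauge (hr0 : ∀ n, 0 < r n) (hrl : Tendsto r atTop (nhds 0))
    (hN0 : 0 < N 0) (hN : ∀ n, 2 * N n ≤ N (n + 1)) : IsContinuousGauge (theGauge r N) := by
  have hc : Continuous (theGauge r N) :=
    ENNReal.continuous_ofReal.comp (realGauge_continuous hr0 hN0 hN)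
  have hm : Monotone (theGauge r N) := fun a b hab =>
    ENNReal.ofReal_le_ofReal (realGauge_mono hN0 hN hab)
  have hrc : ∀ x : ENNReal,
      Tendsto (theGauge r N) (nhdsWithin x (Set.Ioi x)) (nhds (theGauge r N x)) := fun x =>
    (hc.tendsto x).mono_left nhdsWithin_le_nhds
  refine And.intro (And.intro hm (And.intro (fun x => ?_) hrc)) hc.continuousOn
  refine ⟨fun hx => ?_, fun hx => by rw [hx]; exact theGauge_zero⟩
  by_contra hx0
  have hl : Tendsto (fun n => 3 * ENNReal.ofReal (r (n + 1))) atTop (nhds (3 * 0)) := by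
    refine ENNReal.Tendsto.const_mul ?_ (Or.inr (by simp))
    have := ENNReal.tendsto_ofReal (hrl.comp (tendsto_add_atTop_nat 1))
    simpa using this
  rw [mul_zero] at hl
  obtain ⟨n, hn⟩ := (hl.eventually_lt_const (pos_iff_ne_zero.2 hx0)).exists
  have := theGauge_lower hr0 hN0 hN n hn.le
  rw [hx] at this
  simp at this

end gauge

/-- A chain of balanced structures describing a set `Q`. -/
structure GChain {X : Type*} [MetricSpace X] (F : ℕ → Finset X) (r : ℕ → ℝ) (Q : Set X) :
    Prop where
  pos : ∀ n, 0 < r n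
  half : ∀ n, r (n + 1) ≤ r n / 2
  sep : ∀ n, ∀ x ∈ F n, ∀ y ∈ F n, x ≠ y → 5 * r n ≤ dist x y
  nest : ∀ n, ∀ z ∈ F (n + 1), ∃ x ∈ F n, Metric.ball z (r (n + 1)) ⊆ Metric.ball x (r n)
  count : ∀ n, ∃ a, 2 ≤ a ∧ ∀ x ∈ F n, ((F (n + 1) : Set X) ∩ Metric.ball x (r n)).ncard = a
  ne : (F 0).Nonempty
  cov : ∀ n, ∀ p ∈ Q, ∃ x ∈ F n, p ∈ Metric.ball x (r n)
  meet : ∀ n, ∀ x ∈ F n, (Q ∩ Metric.ball x (r n)).Nonempty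

namespace GChain

variable {X : Type*} [MetricSpace X] {F : ℕ → Finset X} {r : ℕ → ℝ} {Q : Set X}

lemma anti (c : GChain F r Q) : Antitone r :=
  antitone_nat_of_succ_le (fun n => by have := c.half n; have := c.pos n; linarith)

lemma lim (c : GChain F r Q) : Tendsto r atTop (nhds 0) := by
  have h : ∀ n, r n ≤ r 0 * (1 / 2) ^ n := by
    intro n
    induction n with
    | zero => simp
    | succ k ih => have := c.half k; rw [pow_succ]; linarith
  have h2 : Tendsto (fun n : ℕ => r 0 * (1 / 2 : ℝ) ^ n) atTop (nhds (r 0 * 0)) :=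
    (tendsto_pow_atTop_nhds_zero_of_lt_one (by norm_num) (by norm_num)).const_mul _
  rw [mul_zero] at h2
  exact squeeze_zero (fun n => (c.pos n).le) h h2

/-- Points of two balls of the same level at distance `< 3 r` are in the same ball. -/
lemma eq_of (c : GChain F r Q) {n : ℕ} {x y u v : X} (hx : x ∈ F n) (hy : y ∈ F n)
    (hu : u ∈ Metric.ball x (r n)) (hv : v ∈ Metric.ball y (r n)) (huv : dist u v < 3 * r n) :
    x = y := by
  by_contra hne
  have h1 := c.sep n x hx y hy hne
  have h2 : dist x u < r n := by rw [dist_comm]; exact hu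
  have h3 : dist v y < r n := hv
  have := dist_triangle4 x u v y
  linarith

lemma eq_of' (c : GChain F r Q) {n : ℕ} {x y u : X} (hx : x ∈ F n) (hy : y ∈ F n)
    (hu : u ∈ Metric.ball x (r n)) (hv : u ∈ Metric.ball y (r n)) : x = y :=
  c.eq_of hx hy hu hv (by rw [dist_self]; have := c.pos n; linarith)

lemma nest' (c : GChain F r Q) {k n : ℕ} (hkn : k ≤ n) : ∀ z ∈ F n, ∃ x ∈ F k,
    Metric.ball z (r n) ⊆ Metric.ball x (r k) := by
  induction n, hkn using Nat.le_induction with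
  | base => exact fun z hz => ⟨z, hz, le_rfl⟩
  | succ n hn ih =>
    intro z hz
    obtain ⟨w, hw, h1⟩ := c.nest n z hz
    obtain ⟨x, hx, h2⟩ := ih w hw
    exact ⟨x, hx, h1.trans h2⟩

/-- If a ball of level `n` meets a ball of level `k ≤ n` then it is inside. -/
lemma sub_of_meet (c : GChain F r Q) {k n : ℕ} (hkn : k ≤ n) {z x p : X} (hz : z ∈ F n)
    (hx : x ∈ F k) (hp : p ∈ Metric.ball z (r n)) (hp' : p ∈ Metric.ball x (r k)) :
    Metric.ball z (r n) ⊆ Metric.ball x (r k) := by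
  obtain ⟨y, hy, h⟩ := c.nest' hkn z hz
  rwa [c.eq_of' hx hy hp' (h hp)]

lemma fin (n : ℕ) (A : Set X) : ((F n : Set X) ∩ A).Finite := (F n).finite_toSet.inter_of_left _

open Classical in
/-- The key count: sum over pieces of the number of children. -/
lemma count_step (c : GChain F r Q) (n : ℕ) {a : ℕ}
    (ha : ∀ x ∈ F n, ((F (n + 1) : Set X) ∩ Metric.ball x (r n)).ncard = a)
    {k : ℕ} (hk : k ≤ n) {x : X} (hx : x ∈ F k) :
    ((F (n + 1) : Set X) ∩ Metric.ball x (r k)).ncard =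
      ((F n : Set X) ∩ Metric.ball x (r k)).ncard * a := by
  have e : ∀ (m : ℕ) (y : X) (s : ℝ), ((F m : Set X) ∩ Metric.ball y s).ncard =
      ((F m).filter (fun z => z ∈ Metric.ball y s)).card := by
    intro m y s
    rw [← Set.ncard_coe_finset]
    congr 1
    ext z
    simp
  simp only [e] at ha ⊢
  rw [← Finset.sum_const_nat (s := (F n).filter (fun z => z ∈ Metric.ball x (r k)))
    (f := fun w => ((F (n + 1)).filter (fun z => z ∈ Metric.ball w (r n))).card)
    (fun w hw => ha w (Finset.mem_filter.1 hw).1), ← Finset.card_biUnion]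
  · congr 1
    ext z
    simp only [Finset.mem_filter, Finset.mem_biUnion]
    constructor
    · rintro ⟨hz, hzx⟩
      obtain ⟨w, hw, h⟩ := c.nest n z hz
      have hzw := h (Metric.mem_ball_self (c.pos _))
      exact ⟨w, ⟨hw, c.sub_of_meet hk hw hx hzw hzx (Metric.mem_ball_self (c.pos _))⟩, hz, hzw⟩
    · rintro ⟨w, ⟨hw, hwx⟩, hz, hzw⟩
      exact ⟨hz, c.sub_of_meet hk hw hx (Metric.mem_ball_self (c.pos _)) hwx hzw⟩
  · intro w hw w' hw' hne
    rw [Function.onFun, Finset.disjoint_left]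
    intro z hz hz'
    simp only [Finset.coe_filter, Set.mem_ofPred_eq, Finset.mem_filter] at hw hw' hz hz'
    exact hne (c.eq_of' hw.1 hw'.1 hz.2 hz'.2)

lemma card_step (c : GChain F r Q) (n : ℕ) {a : ℕ}
    (ha : ∀ x ∈ F n, ((F (n + 1) : Set X) ∩ Metric.ball x (r n)).ncard = a) :
    (F (n + 1)).card = (F n).card * a := by
  classical
  have e : ∀ (m : ℕ) (y : X) (s : ℝ), ((F m : Set X) ∩ Metric.ball y s).ncard =
      ((F m).filter (fun z => z ∈ Metric.ball y s)).card := by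
    intro m y s
    rw [← Set.ncard_coe_finset]
    congr 1
    ext z
    simp
  simp only [e] at ha
  rw [← Finset.sum_const_nat (s := F n)
    (f := fun w => ((F (n + 1)).filter (fun z => z ∈ Metric.ball w (r n))).card)
    ha, ← Finset.card_biUnion]
  · congr 1
    ext z
    simp only [Finset.mem_filter, Finset.mem_biUnion]
    constructor
    · intro hz
      obtain ⟨w, hw, h⟩ := c.nest n z hz
      exact ⟨w, hw, hz, h (Metric.mem_ball_self (c.pos _))⟩
    · rintro ⟨w, hw, hz, hzw⟩
      exact hz
  · intro w hw w' hw' hne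
    rw [Function.onFun, Finset.disjoint_left]
    intro z hz hz'
    rw [Finset.mem_filter] at hz hz'
    exact hne (c.eq_of' hw hw' hz.2 hz'.2)

lemma card_pos (c : GChain F r Q) : 0 < (F 0).card := c.ne.card_pos

lemma card_double (c : GChain F r Q) (n : ℕ) : 2 * (F n).card ≤ (F (n + 1)).card := by
  obtain ⟨a, h2, ha⟩ := c.count n
  rw [c.card_step n ha, mul_comm]
  exact Nat.mul_le_mul_left _ h2

lemma count_mul (c : GChain F r Q) {k n : ℕ} (hkn : k ≤ n) {x : X} (hx : x ∈ F k) :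
    ((F n : Set X) ∩ Metric.ball x (r k)).ncard * (F k).card = (F n).card := by
  induction n, hkn using Nat.le_induction with
  | base =>
    have : (F k : Set X) ∩ Metric.ball x (r k) = {x} := by
      ext z
      simp only [Set.mem_inter_iff, Set.mem_singleton_iff]
      constructor
      · rintro ⟨hz, hzx⟩
        exact c.eq_of' hz hx (Metric.mem_ball_self (c.pos _)) hzx
      · rintro rfl
        exact ⟨hx, Metric.mem_ball_self (c.pos _)⟩
    rw [this]; simp
  | succ n hn ih =>
    obtain ⟨a, h2, ha⟩ := c.count n
    rw [c.count_step n ha hn hx, c.card_step n ha, ← ih]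
    ring

lemma cpos (c : GChain F r Q) (n : ℕ) : 0 < (F n).card :=
  (N_tail (N := fun n => (F n).card) c.card_pos c.card_double n 0).1

lemma inv_lim (c : GChain F r Q) :
    Tendsto (fun n => ((F n).card : ENNReal)⁻¹) atTop (nhds 0) := by
  have h : Tendsto (fun n => (F n).card) atTop atTop := by
    have : StrictMono (fun n => (F n).card) := strictMono_nat_of_lt_succ (fun n => by
      have := c.card_double n; have := c.cpos n; omega)
    exact this.tendsto_atTop
  exact ENNReal.tendsto_inv_nat_nhds_zero.comp h

/-- The gauge of a chain. -/
noncomputable def gauge (F : ℕ → Finset X) (r : ℕ → ℝ) : ENNReal → ENNReal :=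
  theGauge r (fun n => (F n).card)

/-- Any small set is, within `Q`, in a piece of comparable measure. -/
lemma small_set (c : GChain F r Q) {U : Set X} (hU : Metric.ediam U ≤ ENNReal.ofReal (r 0))
    {ε : ENNReal} (hε : 0 < ε) : ∃ k, ∃ x ∈ F k, U ∩ Q ⊆ Metric.ball x (r k) ∧
      ((F k).card : ENNReal)⁻¹ ≤ (⨆ _ : U.Nonempty, gauge F r (Metric.ediam U)) + ε := by
  obtain ⟨m, hm⟩ := (c.inv_lim.eventually_lt_const hε).exists
  rcases (U ∩ Q).eq_empty_or_nonempty with he | ⟨u, hu, huQ⟩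
  · obtain ⟨x, hx⟩ := Finset.card_pos.1 (c.cpos m)
    refine ⟨m, x, hx, by simp [he], hm.le.trans le_add_self⟩
  · have hne : U.Nonempty := ⟨u, hu⟩
    have key : ∀ k, Metric.ediam U < 3 * ENNReal.ofReal (r k) →
        ∃ x ∈ F k, U ∩ Q ⊆ Metric.ball x (r k) := by
      intro k hk
      obtain ⟨x, hx, hux⟩ := c.cov k u huQ
      refine ⟨x, hx, ?_⟩
      rintro v ⟨hv, hvQ⟩
      obtain ⟨y, hy, hvy⟩ := c.cov k v hvQ
      have h1 : edist u v < ENNReal.ofReal (3 * r k) := by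
        rw [ENNReal.ofReal_mul (by norm_num), ENNReal.ofReal_ofNat]
        exact (Metric.edist_le_ediam_of_mem hu hv).trans_lt hk
      rw [edist_dist, ENNReal.ofReal_lt_ofReal_iff (by have := c.pos k; linarith)] at h1
      rw [c.eq_of hx hy hux hvy h1]
      exact hvy
    have p3 : ∀ k, 0 < 3 * ENNReal.ofReal (r k) := fun k => by
      have := ENNReal.ofReal_pos.2 (c.pos k)
      exact ENNReal.mul_pos (by simp) this.ne'
    rcases eq_or_ne (Metric.ediam U) 0 with h0 | h0
    · obtain ⟨x, hx, h⟩ := key m (by rw [h0]; exact p3 m)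
      exact ⟨m, x, hx, h, hm.le.trans le_add_self⟩
    · classical
      have hl : Tendsto (fun n => 3 * ENNReal.ofReal (r (n + 1))) atTop (nhds (3 * 0)) := by
        refine ENNReal.Tendsto.const_mul ?_ (Or.inr (by simp))
        have := ENNReal.tendsto_ofReal (c.lim.comp (tendsto_add_atTop_nat 1))
        simpa using this
      rw [mul_zero] at hl
      have hex : ∃ n, 3 * ENNReal.ofReal (r (n + 1)) ≤ Metric.ediam U := by
        obtain ⟨n, hn⟩ := (hl.eventually_lt_const (pos_iff_ne_zero.2 h0)).exists
        exact ⟨n, hn.le⟩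
      have hk := Nat.find_spec hex
      have hlt : Metric.ediam U < 3 * ENNReal.ofReal (r (Nat.find hex)) := by
        rcases hf : Nat.find hex with _ | j
        · refine hU.trans_lt ?_
          have h1 := ENNReal.ofReal_pos.2 (c.pos 0)
          calc ENNReal.ofReal (r 0) = 1 * ENNReal.ofReal (r 0) := (one_mul _).symm
            _ < 3 * ENNReal.ofReal (r 0) :=
              ENNReal.mul_lt_mul_left h1.ne' ENNReal.ofReal_ne_top (by norm_num)
        · have := Nat.find_min hex (m := j) (by omega)
          exact not_le.1 this
      obtain ⟨x, hx, h⟩ := key _ hlt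
      refine ⟨_, x, hx, h, ?_⟩
      rw [iSup_pos hne]
      exact (theGauge_lower c.pos c.card_pos c.card_double _ hk).trans le_self_add

variable [MeasurableSpace X] [BorelSpace X]

lemma lower (c : GChain F r Q) (hQ : IsCompact Q) :
    0 < Measure.mkMetric (gauge F r) Q := by
  refine lt_of_lt_of_le (b := (2 : ENNReal)⁻¹) (by simp) ?_
  rw [Measure.mkMetric_apply]
  refine le_iSup₂_of_le (ENNReal.ofReal (r 0)) (ENNReal.ofReal_pos.2 (c.pos 0)) ?_
  refine le_iInf fun t => le_iInf fun ht => le_iInf fun hd => ?_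
  obtain ⟨ε, hε, hsum⟩ := ENNReal.exists_pos_sum_of_countable' (ε := 2⁻¹) (by simp) ℕ
  choose k x hx hsub hle using fun i => c.small_set (hd i) (hε i)
  obtain ⟨J, hJ⟩ := hQ.elim_finite_subcover (fun i => Metric.ball (x i) (r (k i)))
    (fun i => Metric.isOpen_ball) (by
      intro p hp
      obtain ⟨i, hi⟩ := Set.mem_iUnion.1 (ht hp)
      exact Set.mem_iUnion.2 ⟨i, hsub i ⟨hi, hp⟩⟩)
  set n := J.sup k with hn
  have hkn : ∀ i ∈ J, k i ≤ n := fun i hi => Finset.le_sup hi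
  have hc1 : (F n : Set X) ⊆ ⋃ i ∈ J, ((F n : Set X) ∩ Metric.ball (x i) (r (k i))) := by
    intro z hz
    obtain ⟨p, hpQ, hpz⟩ := c.meet n z hz
    obtain ⟨i, hiJ, hi⟩ := Set.mem_iUnion₂.1 (hJ hpQ)
    refine Set.mem_iUnion₂.2 ⟨i, hiJ, hz, ?_⟩
    exact c.sub_of_meet (hkn i hiJ) hz (hx i) hpz hi (Metric.mem_ball_self (c.pos _))
  have hc2 : (F n).card ≤ ∑ i ∈ J, ((F n : Set X) ∩ Metric.ball (x i) (r (k i))).ncard := by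
    rw [← Set.ncard_coe_finset]
    refine (Set.ncard_le_ncard hc1 ?_).trans ?_
    · exact J.finite_toSet.biUnion (fun i _ => fin n _)
    · exact Finset.set_ncard_biUnion_le _ _
  have hNn : ((F n).card : ENNReal) ≠ 0 := by exact_mod_cast (c.cpos n).ne'
  have hc3 : (1 : ENNReal) ≤ ∑ i ∈ J, ((F (k i)).card : ENNReal)⁻¹ := by
    have h1 : ((F n).card : ENNReal) ≤ ((F n).card : ENNReal) *
        ∑ i ∈ J, ((F (k i)).card : ENNReal)⁻¹ := by
      rw [Finset.mul_sum]
      calc ((F n).card : ENNReal) ≤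
          ((∑ i ∈ J, ((F n : Set X) ∩ Metric.ball (x i) (r (k i))).ncard : ℕ) : ENNReal) := by
            exact_mod_cast hc2
        _ = ∑ i ∈ J, ((((F n : Set X) ∩ Metric.ball (x i) (r (k i))).ncard : ℕ) : ENNReal) := by
            push_cast; rfl
        _ ≤ _ := by
            refine Finset.sum_le_sum fun i hi => ?_
            rw [← c.count_mul (hkn i hi) (hx i), Nat.cast_mul, mul_assoc,
              ENNReal.mul_inv_cancel (by exact_mod_cast (c.cpos _).ne') (by simp), mul_one]
    have h2 := ENNReal.div_le_of_le_mul' h1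
    rwa [ENNReal.div_self hNn (by simp)] at h2
  have hc4 : (1 : ENNReal) ≤
      (∑' i, ⨆ _ : (t i).Nonempty, gauge F r (Metric.ediam (t i))) + 2⁻¹ := by
    calc (1 : ENNReal) ≤ ∑ i ∈ J, ((F (k i)).card : ENNReal)⁻¹ := hc3
      _ ≤ ∑ i ∈ J, ((⨆ _ : (t i).Nonempty, gauge F r (Metric.ediam (t i))) + ε i) :=
          Finset.sum_le_sum fun i _ => hle i
      _ ≤ ∑' i, ((⨆ _ : (t i).Nonempty, gauge F r (Metric.ediam (t i))) + ε i) :=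
          ENNReal.sum_le_tsum J
      _ = (∑' i, ⨆ _ : (t i).Nonempty, gauge F r (Metric.ediam (t i))) + ∑' i, ε i :=
          ENNReal.tsum_add
      _ ≤ _ := by gcongr
  have := tsub_le_iff_right.2 hc4
  rwa [ENNReal.one_sub_inv_two] at this

/-- Covering bound. -/
lemma cover (c : GChain F r Q) {A : Set X} {v : ENNReal}
    (h : ∀ n0, ∃ n ≥ n0, ∃ G : Finset X, (∀ p ∈ A, ∃ x ∈ G, p ∈ Metric.ball x (r n)) ∧
      (G.card : ENNReal) * (2 * ((F n).card : ENNReal)⁻¹) ≤ v) :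
    Measure.mkMetric (gauge F r) A ≤ v := by
  choose n hn G hG hv using h
  have hnl : Tendsto n atTop atTop := tendsto_atTop_mono hn tendsto_id
  have hdiam : ∀ j (x : X), Metric.ediam (Metric.ball x (r (n j))) ≤
      2 * ENNReal.ofReal (r (n j)) := by
    intro j x
    have := Metric.ediam_eball_le (x := x) (r := ENNReal.ofReal (r (n j)))
    rwa [Metric.eball_ofReal] at this
  have := Measure.mkMetric_le_liminf_sum (ι := fun j => (G j)) A (l := atTop)
    (fun j => 2 * ENNReal.ofReal (r (n j))) (by
      have := ENNReal.Tendsto.const_mul (a := 2) (ENNReal.tendsto_ofReal (c.lim.comp hnl))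
        (Or.inr (by simp))
      simpa using this)
    (fun j x => Metric.ball (x : X) (r (n j)))
    (Eventually.of_forall fun j x => hdiam j x)
    (Eventually.of_forall fun j p hp => by
      obtain ⟨x, hx, h⟩ := hG j p hp
      exact Set.mem_iUnion.2 ⟨⟨x, hx⟩, h⟩) (gauge F r)
  refine this.trans ?_
  refine liminf_le_of_le (by isBoundedDefault) fun b hb => ?_
  obtain ⟨j, hj⟩ := hb.exists
  refine hj.trans (le_trans ?_ (hv j))
  calc _ ≤ ∑ x : (G j), (2 * ((F (n j)).card : ENNReal)⁻¹) :=
        Finset.sum_le_sum fun x _ => theGauge_upper c.anti c.card_pos c.card_double _ (hdiam j x)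
    _ = _ := by simp

lemma upper (c : GChain F r Q) : Measure.mkMetric (gauge F r) Q < ⊤ := by
  refine lt_of_le_of_lt (c.cover (v := 2) fun n0 => ⟨n0, le_rfl, F n0, c.cov n0, ?_⟩) (by simp)
  rw [mul_left_comm, ENNReal.mul_inv_cancel (by exact_mod_cast (c.cpos _).ne') (by simp), mul_one]

lemma null_singleton (x : X) : Measure.mkMetric (gauge F r) {x} = 0 := by
  rw [← nonpos_iff_eq_zero, Measure.mkMetric_apply]
  refine iSup₂_le fun s hs => ?_
  refine iInf_le_of_le (fun _ => {x}) (iInf_le_of_le (by simp) (iInf_le_of_le (by simp) ?_))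
  simp [gauge, theGauge_zero]

lemma null_countable {A : Set X} (hA : A.Countable) : Measure.mkMetric (gauge F r) A = 0 := by
  have : A = ⋃ x ∈ A, {x} := by simp
  rw [this]
  exact (measure_biUnion_null_iff hA).2 fun x _ => null_singleton x

end GChain

/-- The condition used to kill images of weak contractions. -/
def WCond {X : Type*} [MetricSpace X] (F : Finset X) (r : ℝ) (d : X) (q : ℝ) (n : ℕ) : Prop :=
  ∃ s : ℝ, ∃ E : Finset X, (n + 1) * E.card ≤ F.card ∧
    (∀ z ∈ F, ∀ z' ∈ F, ∀ u ∈ Metric.ball z r, ∀ v ∈ Metric.ball z' r,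
      dist u d < q → dist v d < q → dist u v < s → z = z') ∧
    (∀ z ∈ F, ∀ u ∈ Metric.ball z r, 2 * q ≤ dist u d → ∃ e ∈ E, dist u e < s / 2)

section contraction

variable {X : Type*} [MetricSpace X] {F : ℕ → Finset X} {r : ℕ → ℝ} {Q : Set X}

lemma wcond_cover {F : Finset X} {r : ℝ} {d : X} {q : ℝ} {n : ℕ} (h : WCond F r d q n)
    (hQ : ∀ p ∈ Q, ∃ x ∈ F, p ∈ Metric.ball x r) (f : X → X)
    (hf : ∀ x ∈ Q, ∀ y ∈ Q, x ≠ y → dist (f x) (f y) < dist x y) :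
    ∃ G : Finset X, (n + 1) * G.card ≤ F.card ∧
      ∀ p ∈ Q, dist p d < q → (∃ u ∈ Q, 2 * q ≤ dist u d ∧ f u = p) →
        ∃ x ∈ G, p ∈ Metric.ball x r := by
  classical
  obtain ⟨s, E, hE, h1, h2⟩ := h
  have key : ∀ e : X, ∃ z : X, ∀ p ∈ Q, dist p d < q →
      (∃ u ∈ Q, dist u e < s / 2 ∧ f u = p) → p ∈ Metric.ball z r := by
    intro e
    by_cases hex : ∃ p ∈ Q, dist p d < q ∧ ∃ u ∈ Q, dist u e < s / 2 ∧ f u = p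
    · obtain ⟨p, hp, hpd, u, hu, hue, hup⟩ := hex
      obtain ⟨z, hz, hpz⟩ := hQ p hp
      refine ⟨z, ?_⟩
      rintro p' hp' hpd' ⟨u', hu', hue', hup'⟩
      obtain ⟨z', hz', hpz'⟩ := hQ p' hp'
      have hd : dist p p' < s := by
        have h3 : dist u u' < s := by
          have := dist_triangle_right u u' e
          linarith
        by_cases huu : u = u'
        · subst huu
          rw [← hup, ← hup', dist_self]
          have := dist_nonneg (x := u) (y := e)
          linarith
        · rw [← hup, ← hup']
          exact (hf u hu u' hu' huu).trans h3
      rw [h1 z hz z' hz' p hpz p' hpz' hpd hpd' hd]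
      exact hpz'
    · refine ⟨e, fun p hp hpd hu => ?_⟩
      exact (hex ⟨p, hp, hpd, hu⟩).elim
  choose g hg using key
  refine ⟨E.image g, (Nat.mul_le_mul_left _ Finset.card_image_le).trans hE, ?_⟩
  rintro p hp hpd ⟨u, hu, hud, hup⟩
  obtain ⟨z, hz, huz⟩ := hQ u hu
  obtain ⟨e, he, hue⟩ := h2 z hz u huz hud
  exact ⟨g e, Finset.mem_image_of_mem _ he, hg e p hp hpd ⟨u, hu, hue, hup⟩⟩

variable [MeasurableSpace X] [BorelSpace X]

lemma GChain.null_pair (c : GChain F r Q) {d : X} {q : ℝ}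
    (h : ∀ n0, ∃ n ≥ n0, WCond (F (n + 1)) (r (n + 1)) d q n) (f : X → X)
    (hf : ∀ x ∈ Q, ∀ y ∈ Q, x ≠ y → dist (f x) (f y) < dist x y) :
    Measure.mkMetric (gauge F r)
      {p | p ∈ Q ∧ dist p d < q ∧ ∃ u ∈ Q, 2 * q ≤ dist u d ∧ f u = p} = 0 := by
  have main : ∀ m : ℕ, Measure.mkMetric (gauge F r)
      {p | p ∈ Q ∧ dist p d < q ∧ ∃ u ∈ Q, 2 * q ≤ dist u d ∧ f u = p} ≤
        2 * ((m : ENNReal))⁻¹ := by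
    intro m
    refine c.cover fun n0 => ?_
    obtain ⟨n, hn, hw⟩ := h (max n0 m)
    obtain ⟨G, hG, hcov⟩ := wcond_cover hw (c.cov (n + 1)) f hf
    refine ⟨n + 1, by have := le_max_left n0 m; omega, G, ?_, ?_⟩
    · rintro p ⟨hp, hpd, hu⟩
      exact hcov p hp hpd hu
    · rw [mul_left_comm]
      gcongr
      have hmG : m * G.card ≤ (F (n + 1)).card := by
        refine le_trans (Nat.mul_le_mul_right _ ?_) hG
        have := le_max_right n0 m; omega
      have hF0 : ((F (n + 1)).card : ENNReal) ≠ 0 := by exact_mod_cast (c.cpos _).ne'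
      rw [← div_eq_mul_inv]
      refine ENNReal.div_le_of_le_mul ?_
      rw [mul_comm, ← div_eq_mul_inv, ENNReal.le_div_iff_mul_le (Or.inr hF0) (Or.inl (by simp)),
        mul_comm]
      exact_mod_cast hmG
  have hl : Tendsto (fun m : ℕ => 2 * ((m : ENNReal))⁻¹) atTop (nhds (2 * 0)) :=
    ENNReal.Tendsto.const_mul ENNReal.tendsto_inv_nat_nhds_zero (Or.inr (by simp))
  rw [mul_zero] at hl
  exact le_antisymm (ge_of_tendsto' hl main) (zero_le)

lemma GChain.null_contraction (c : GChain F r Q) {D : Set X} (hDc : D.Countable) (hD : Dense D)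
    (h : ∀ d ∈ D, ∀ k : ℕ, ∀ n0, ∃ n ≥ n0,
      WCond (F (n + 1)) (r (n + 1)) d (1 / ((k : ℝ) + 1)) n) (f : X → X)
    (hf : ∀ x ∈ Q, ∀ y ∈ Q, x ≠ y → dist (f x) (f y) < dist x y) :
    Measure.mkMetric (gauge F r) (Q ∩ f '' Q) = 0 := by
  have hsub : Q ∩ f '' Q ⊆ {x | x ∈ Q ∧ f x = x} ∪ ⋃ d ∈ D, ⋃ k : ℕ,
      {p | p ∈ Q ∧ dist p d < 1 / ((k : ℝ) + 1) ∧
        ∃ u ∈ Q, 2 * (1 / ((k : ℝ) + 1)) ≤ dist u d ∧ f u = p} := by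
    rintro p ⟨hp, u, hu, hup⟩
    by_cases hpu : p = u
    · left
      subst hpu
      exact ⟨hp, hup⟩
    · right
      have hpos : 0 < dist u p / 3 := by
        have := dist_pos.2 (Ne.symm hpu)
        linarith
      obtain ⟨k, hk⟩ := exists_nat_one_div_lt hpos
      obtain ⟨d, hdD, hd⟩ := hD.exists_dist_lt p (Nat.one_div_pos_of_nat (α := ℝ) (n := k))
      refine Set.mem_iUnion₂.2 ⟨d, hdD, Set.mem_iUnion.2 ⟨k, hp, hd, u, hu, ?_, hup⟩⟩
      have := dist_triangle_right u p d
      linarith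
  refine measure_mono_null hsub (measure_union_null ?_ ?_)
  · apply GChain.null_countable
    apply Set.Subsingleton.countable
    rintro x ⟨hx, hfx⟩ y ⟨hy, hfy⟩
    by_contra hne
    have := hf x hx y hy hne
    rw [hfx, hfy] at this
    exact lt_irrefl _ this
  · refine (measure_biUnion_null_iff hDc).2 fun d hd => measure_iUnion_null fun k => ?_
    exact c.null_pair (h d hd k) f hf

end contraction

section density

variable {X : Type*} [MetricSpace X]

/-- Isolated points. -/
def isoPts (X : Type*) [MetricSpace X] : Set X := {x | IsOpen ({x} : Set X)}

/-- The open part without isolated points. -/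
def perfPart (X : Type*) [MetricSpace X] : Set X := (closure (isoPts X))ᶜ

lemma isOpen_isoPts : IsOpen (isoPts X) := by
  rw [isOpen_iff_mem_nhds]
  intro x hx
  have hx' : IsOpen ({x} : Set X) := hx
  refine Filter.mem_of_superset (hx'.mem_nhds rfl) ?_
  rintro y rfl
  exact hx

lemma isOpen_perfPart : IsOpen (perfPart X) := isClosed_closure.isOpen_compl

lemma not_iso_of_perf {x : X} (hx : x ∈ perfPart X) : x ∉ isoPts X :=
  fun h => hx (subset_closure h)

lemma dense_D0 {D : Set X} (hD : Dense D) : Dense (D ∩ (isoPts X ∪ perfPart X)) := by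
  refine hD.inter_of_isOpen_right ?_ (isOpen_isoPts.union isOpen_perfPart)
  intro x
  by_cases hx : x ∈ closure (isoPts X)
  · exact closure_mono subset_union_left hx
  · exact subset_closure (Or.inr hx)

lemma infinite_inter {D V : Set X} (hD : Dense D) (hV : IsOpen V) (hne : V.Nonempty)
    (hVP : V ⊆ perfPart X) : (D ∩ V).Infinite := by
  intro hfin
  have h1 : V ⊆ D ∩ V := by
    have := hD.open_subset_closure_inter hV
    rw [inter_comm, hfin.isClosed.closure_eq] at this
    exact this
  have hVf : V.Finite := hfin.subset h1
  obtain ⟨v, hv⟩ := hne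
  have h2 : IsOpen ({v} : Set X) := by
    have h3 : ({v} : Set X) = V ∩ (V \ {v})ᶜ := by
      ext w
      simp only [mem_singleton_iff, mem_inter_iff, mem_compl_iff, Set.mem_sdiff]
      constructor
      · rintro rfl
        exact ⟨hv, fun h => h.2 rfl⟩
      · rintro ⟨hw, h⟩
        by_contra hne
        exact h ⟨hw, hne⟩
    rw [h3]
    exact hV.inter (hVf.subset sdiff_subset).isClosed.isOpen_compl
  exact not_iso_of_perf (hVP hv) h2

/-- Validity of a structure. -/
structure Valid (D : Set X) (F : Finset X) (r : ℝ) : Prop where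
  pos : 0 < r
  rad : ∃ k : ℕ, r = 1 / ((k : ℝ) + 1)
  subD : (F : Set X) ⊆ D
  perf : ∀ x ∈ F, Metric.ball x r ⊆ perfPart X
  sep : ∀ x ∈ F, ∀ y ∈ F, x ≠ y → 5 * r ≤ dist x y

/-- The open set of compact sets described by a structure. -/
def Nbd (F : Finset X) (r : ℝ) : Set (NonemptyCompacts X) :=
  {K | (K : Set X) ⊆ isoPts X ∪ ⋃ x ∈ F, Metric.ball x r} ∩
    ⋂ x ∈ F, {K | ((K : Set X) ∩ Metric.ball x r).Nonempty}

lemma isOpen_Nbd (F : Finset X) (r : ℝ) : IsOpen (Nbd F r) := by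
  refine (NonemptyCompacts.isOpen_subsets_of_isOpen (isOpen_isoPts.union
    (isOpen_biUnion fun x _ => Metric.isOpen_ball))).inter ?_
  exact isOpen_biInter_finset fun x _ =>
    NonemptyCompacts.isOpen_inter_nonempty_of_isOpen Metric.isOpen_ball

/-- Refinement of structures. -/
structure Refine (F : Finset X) (r : ℝ) (F' : Finset X) (r' : ℝ) : Prop where
  half : r' ≤ r / 2
  nest : ∀ z ∈ F', ∃ x ∈ F, Metric.ball z r' ⊆ Metric.ball x r
  count : ∃ a, 2 ≤ a ∧ ∀ x ∈ F, ((F' : Set X) ∩ Metric.ball x r).ncard = a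

lemma ev_pos : ∀ᶠ ρ in nhdsWithin (0 : ℝ) (Ioi 0), 0 < ρ := self_mem_nhdsWithin

lemma ev_lt {c : ℝ} (hc : 0 < c) : ∀ᶠ ρ in nhdsWithin (0 : ℝ) (Ioi 0), ρ < c :=
  nhdsWithin_le_nhds (gt_mem_nhds hc)

lemma ev_ball {O : Set X} (hO : IsOpen O) {x : X} (hx : x ∈ O) :
    ∀ᶠ ρ in nhdsWithin (0 : ℝ) (Ioi 0), Metric.ball x ρ ⊆ O := by
  obtain ⟨ε, hε, h⟩ := Metric.isOpen_iff.1 hO x hx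
  filter_upwards [ev_lt hε] with ρ hρ
  exact (Metric.ball_subset_ball hρ.le).trans h

lemma ev_sep (F : Finset X) : ∀ᶠ ρ in nhdsWithin (0 : ℝ) (Ioi 0),
    ∀ x ∈ F, ∀ y ∈ F, x ≠ y → 5 * ρ ≤ dist x y := by
  rw [Filter.eventually_all_finset]
  intro x _
  rw [Filter.eventually_all_finset]
  intro y _
  by_cases hxy : x = y
  · exact Eventually.of_forall fun ρ h => (h hxy).elim
  · filter_upwards [ev_lt (c := dist x y / 5) (by have := dist_pos.2 hxy; linarith)] with ρ hρ _
    linarith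

lemma exists_rad {p : ℝ → Prop} (h : ∀ᶠ ρ in nhdsWithin (0 : ℝ) (Ioi 0), p ρ) :
    ∃ r : ℝ, 0 < r ∧ (∃ k : ℕ, r = 1 / ((k : ℝ) + 1)) ∧ p r := by
  have ht : Tendsto (fun k : ℕ => 1 / ((k : ℝ) + 1)) atTop (nhdsWithin (0 : ℝ) (Ioi 0)) := by
    refine tendsto_nhdsWithin_iff.2 ⟨tendsto_one_div_add_atTop_nhds_zero_nat, ?_⟩
    exact Eventually.of_forall fun k => Set.mem_Ioi.2 Nat.one_div_pos_of_nat
  obtain ⟨k, hk⟩ := (ht.eventually h).exists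
  exact ⟨_, Nat.one_div_pos_of_nat, ⟨k, rfl⟩, hk⟩

lemma exists_initial {D : Set X} (T : NonemptyCompacts X)
    (hfin : (T : Set X).Finite) (hTD : (T : Set X) ⊆ D ∩ (isoPts X ∪ perfPart X)) :
    ∃ F : Finset X, ∃ r : ℝ, Valid D F r ∧ T ∈ Nbd F r := by
  classical
  set F : Finset X := hfin.toFinset.filter (fun x => x ∈ perfPart X) with hF
  have hmem : ∀ x, x ∈ F ↔ x ∈ (T : Set X) ∧ x ∈ perfPart X := by
    intro x; rw [hF, Finset.mem_filter, Set.Finite.mem_toFinset]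
  have h1 : ∀ᶠ ρ in nhdsWithin (0 : ℝ) (Ioi 0), ∀ x ∈ F, Metric.ball x ρ ⊆ perfPart X := by
    rw [Filter.eventually_all_finset]
    intro x hx
    exact ev_ball isOpen_perfPart ((hmem x).1 hx).2
  obtain ⟨r, hr, hrad, hperf, hsep⟩ := exists_rad (h1.and (ev_sep F))
  refine ⟨F, r, ⟨hr, hrad, fun x hx => (hTD ((hmem x).1 hx).1).1, hperf, hsep⟩, ?_, ?_⟩
  · intro x hx
    rcases (hTD hx).2 with h | h
    · exact Or.inl h
    · exact Or.inr (Set.mem_iUnion₂.2 ⟨x, (hmem x).2 ⟨hx, h⟩, Metric.mem_ball_self hr⟩)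
  · exact Set.mem_iInter₂.2 fun x hx => ⟨x, ((hmem x).1 hx).1, Metric.mem_ball_self hr⟩

lemma exists_children {D : Set X} (hD : Dense D) (b : ℕ) {ρ : ℝ} (hρ : 0 < ρ) {y : X}
    (hy : y ∈ perfPart X) : ∃ G : Finset X, (∀ z ∈ G, z ∈ D ∧ dist z y < ρ) ∧ G.card = b := by
  obtain ⟨G, hG, hc⟩ := (infinite_inter hD (Metric.isOpen_ball.inter isOpen_perfPart)
    ⟨y, Metric.mem_ball_self hρ, hy⟩ inter_subset_right).exists_subset_card_eq b
  exact ⟨G, fun z hz => ⟨(hG hz).1, (hG hz).2.1⟩, hc⟩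

lemma exists_step {D : Set X} (hD : Dense D) (T : NonemptyCompacts X)
    (hfin : (T : Set X).Finite) (hTD : (T : Set X) ⊆ D ∩ (isoPts X ∪ perfPart X))
    {F : Finset X} {r : ℝ} (hv : Valid D F r) (hne : F.Nonempty) (hT : T ∈ Nbd F r)
    {ε : ℝ} (hε : 0 < ε) (d : X) {q : ℝ} (hq : 0 < q) (n : ℕ) :
    ∃ F' : Finset X, ∃ r' : ℝ, Valid D F' r' ∧ Refine F r F' r' ∧ WCond F' r' d q n ∧
      ∃ K' ∈ Nbd F' r', dist K' T < ε := by
  classical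
  -- step A: equalize
  have hTF : ∀ x ∈ F, ((T : Set X) ∩ Metric.ball x r).Nonempty := Set.mem_iInter₂.1 hT.2
  have hdisj : ∀ x ∈ F, ∀ y ∈ F, ∀ u ∈ Metric.ball x r, u ∈ Metric.ball y r → x = y := by
    intro x hx y hy u hu hu'
    by_contra hxy
    have h1 := hv.sep x hx y hy hxy
    have h2 := dist_triangle_left x y u
    rw [Metric.mem_ball] at hu hu'
    have := hv.pos
    linarith
  set a := (T : Set X).ncard with ha
  have ha0 : 0 < a := (Set.ncard_pos hfin).2 T.nonempty
  have hA : ∀ x ∈ F, ∃ A : Finset X, (∀ t ∈ (T : Set X), t ∈ Metric.ball x r → t ∈ A) ∧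
      (∀ y ∈ A, y ∈ D ∧ y ∈ Metric.ball x r ∧ ∃ t ∈ (T : Set X), dist y t < ε / 4) ∧
      A.card = a := by
    intro x hx
    have hO : IsOpen (Metric.ball x r ∩ ⋃ t ∈ (T : Set X), Metric.ball t (ε / 4)) :=
      Metric.isOpen_ball.inter (isOpen_biUnion fun t _ => Metric.isOpen_ball)
    have hsub : ∀ t ∈ (T : Set X), t ∈ Metric.ball x r →
        t ∈ Metric.ball x r ∩ ⋃ t ∈ (T : Set X), Metric.ball t (ε / 4) := fun t ht htx =>
      ⟨htx, Set.mem_iUnion₂.2 ⟨t, ht, Metric.mem_ball_self (by linarith)⟩⟩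
    obtain ⟨t0, ht0, ht0x⟩ := hTF x hx
    have hinf := infinite_inter hD hO ⟨t0, hsub t0 ht0 ht0x⟩
      (inter_subset_left.trans (hv.perf x hx))
    obtain ⟨s', h1, h2, h3⟩ := hinf.exists_superset_ncard_eq
      (s := (T : Set X) ∩ Metric.ball x r) (fun t ht => ⟨(hTD ht.1).1, hsub t ht.1 ht.2⟩)
      (hfin.inter_of_left _) (k := a) (Set.ncard_le_ncard inter_subset_left hfin)
    have hs' : s'.Finite := Set.finite_of_ncard_pos (by omega)
    refine ⟨hs'.toFinset, fun t ht htx => ?_, fun y hy => ?_, ?_⟩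
    · rw [Set.Finite.mem_toFinset]
      exact h1 ⟨ht, htx⟩
    · rw [Set.Finite.mem_toFinset] at hy
      obtain ⟨hyD, hyx, hyt⟩ := h2 hy
      obtain ⟨t, ht, hyt⟩ := Set.mem_iUnion₂.1 hyt
      exact ⟨hyD, hyx, t, ht, hyt⟩
    · rw [← Set.ncard_eq_toFinset_card s' hs', h3]
  choose! A hA1 hA2 hA3 using hA
  set AA := F.biUnion A with hAA
  have hAAperf : ∀ y ∈ AA, y ∈ perfPart X := by
    intro y hy
    obtain ⟨x, hx, hyx⟩ := Finset.mem_biUnion.1 hy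
    exact hv.perf x hx (hA2 x hx y hyx).2.1
  -- choice of `η`
  have hη1 : ∀ᶠ η in nhdsWithin (0 : ℝ) (Ioi 0), ∀ x ∈ F, ∀ y ∈ A x,
      Metric.ball y η ⊆ Metric.ball x r := by
    rw [Filter.eventually_all_finset]
    intro x hx
    rw [Filter.eventually_all_finset]
    intro y hy
    exact ev_ball Metric.isOpen_ball (hA2 x hx y hy).2.1
  obtain ⟨η, hη, hηsub, hηsep, hηε, hηq⟩ := (ev_pos.and (hη1.and ((ev_sep AA).and
    ((ev_lt (c := ε / 4) (by linarith)).and (ev_lt (c := q / 4) (by linarith)))))).exists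
  set b := n + 2 with hb
  choose! G hG1 hG2 using fun y (hy : y ∈ AA) => exists_children hD b hη (hAAperf y hy)
  obtain ⟨s1, hs1, hs1sep⟩ := (ev_pos.and (ev_sep (AA.biUnion G))).exists
  set s := 5 * s1 with hs
  have hspos : 0 < s := by linarith
  have hmin : 0 < min η (s / 8) := lt_min hη (by linarith)
  choose! G' hG1' hG2' using fun y (hy : y ∈ AA) => exists_children hD b hmin (hAAperf y hy)
  set wide : X → Prop := fun y => ∃ w, dist w y < η ∧ dist w d < q with hwide
  set H : X → Finset X := fun y => if wide y then G y else G' y with hH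
  have hHw : ∀ y, wide y → H y = G y := fun y h => by simp only [hH]; rw [if_pos h]
  have hHn : ∀ y, ¬ wide y → H y = G' y := fun y h => by simp only [hH]; rw [if_neg h]
  have hHD : ∀ y ∈ AA, ∀ z ∈ H y, z ∈ D ∧ dist z y < η := by
    intro y hy z hz
    by_cases h : wide y
    · rw [hHw y h] at hz
      exact hG1 y hy z hz
    · rw [hHn y h] at hz
      obtain ⟨h1, h2⟩ := hG1' y hy z hz
      exact ⟨h1, h2.trans_le (min_le_left _ _)⟩
  have hHc : ∀ y ∈ AA, (H y).card = b := by
    intro y hy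
    by_cases h : wide y
    · rw [hHw y h]; exact hG2 y hy
    · rw [hHn y h]; exact hG2' y hy
  have hHdisj : ∀ y ∈ AA, ∀ y' ∈ AA, y ≠ y' → Disjoint (H y) (H y') := by
    intro y hy y' hy' hyy
    rw [Finset.disjoint_left]
    intro z hz hz'
    have h1 := (hHD y hy z hz).2
    have h2 := (hHD y' hy' z hz').2
    have h3 := hηsep y hy y' hy' hyy
    have h4 := dist_triangle_left y y' z
    linarith
  set F' := AA.biUnion H with hF'
  have hFcard : F'.card = AA.card * b := by
    rw [hF', Finset.card_biUnion fun y hy y' hy' h => hHdisj y hy y' hy' h]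
    exact Finset.sum_const_nat hHc
  -- choice of `r'`
  have hr1 : ∀ᶠ ρ in nhdsWithin (0 : ℝ) (Ioi 0), ∀ y ∈ AA, ∀ z ∈ H y,
      Metric.ball z ρ ⊆ Metric.ball y η := by
    rw [Filter.eventually_all_finset]
    intro y hy
    rw [Filter.eventually_all_finset]
    intro z hz
    exact ev_ball Metric.isOpen_ball (hHD y hy z hz).2
  obtain ⟨r', hr', hrad, hrsub, hrsep, hrs, hrr⟩ := exists_rad (hr1.and ((ev_sep F').and
    ((ev_lt (c := s / 16) (by linarith)).and (ev_lt (c := r / 2) (by linarith [hv.pos])))))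
  have hparent : ∀ z ∈ F', ∃ x ∈ F, ∃ y ∈ A x, y ∈ AA ∧ z ∈ H y := by
    intro z hz
    obtain ⟨y, hy, hzy⟩ := Finset.mem_biUnion.1 hz
    obtain ⟨x, hx, hyx⟩ := Finset.mem_biUnion.1 hy
    exact ⟨x, hx, y, hyx, hy, hzy⟩
  have hmemAA : ∀ x ∈ F, ∀ y ∈ A x, y ∈ AA := fun x hx y hy => Finset.mem_biUnion.2 ⟨x, hx, hy⟩
  have hnest : ∀ z ∈ F', ∃ x ∈ F, Metric.ball z r' ⊆ Metric.ball x r := by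
    intro z hz
    obtain ⟨x, hx, y, hyx, hy, hzy⟩ := hparent z hz
    exact ⟨x, hx, (hrsub y hy z hzy).trans (hηsub x hx y hyx)⟩
  refine ⟨F', r', ⟨hr', hrad, ?_, ?_, hrsep⟩, ⟨hrr.le, hnest, a * b, ?_, ?_⟩, ?_, ?_⟩
  · intro z hz
    obtain ⟨x, hx, y, hyx, hy, hzy⟩ := hparent z hz
    exact (hHD y hy z hzy).1
  · intro z hz
    obtain ⟨x, hx, h⟩ := hnest z hz
    exact h.trans (hv.perf x hx)
  · have : 1 * 2 ≤ a * b := Nat.mul_le_mul ha0 (by omega)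
    omega
  · intro x hx
    have e : (F' : Set X) ∩ Metric.ball x r = ((A x).biUnion H : Finset X) := by
      ext z
      simp only [mem_inter_iff, Finset.mem_coe]
      constructor
      · rintro ⟨hz, hzx⟩
        obtain ⟨x', hx', y, hyx, hy, hzy⟩ := hparent z hz
        have : x' = x := hdisj x' hx' x hx z (hηsub x' hx' y hyx (hHD y hy z hzy).2) hzx
        subst this
        exact Finset.mem_biUnion.2 ⟨y, hyx, hzy⟩
      · intro hz
        obtain ⟨y, hyx, hzy⟩ := Finset.mem_biUnion.1 hz
        have hy := hmemAA x hx y hyx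
        exact ⟨Finset.mem_biUnion.2 ⟨y, hy, hzy⟩, hηsub x hx y hyx (hHD y hy z hzy).2⟩
    rw [e, Set.ncard_coe_finset, Finset.card_biUnion fun y hy y' hy' h =>
      hHdisj y (hmemAA x hx y hy) y' (hmemAA x hx y' hy') h, ← hA3 x hx]
    exact Finset.sum_const_nat fun y hy => hHc y (hmemAA x hx y hy)
  · refine ⟨s / 2, AA, ?_, ?_, ?_⟩
    · rw [hFcard, mul_comm]
      exact Nat.mul_le_mul_left _ (by omega)
    · intro z hz z' hz' u hu v hv' hud hvd huv
      obtain ⟨x, hx, y, hyx, hy, hzy⟩ := hparent z hz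
      obtain ⟨x', hx', y', hyx', hy', hzy'⟩ := hparent z' hz'
      rw [hHw y ⟨u, hrsub y hy z hzy hu, hud⟩] at hzy
      rw [hHw y' ⟨v, hrsub y' hy' z' hzy' hv', hvd⟩] at hzy'
      by_contra hzz
      have h1 := hs1sep z (Finset.mem_biUnion.2 ⟨y, hy, hzy⟩) z'
        (Finset.mem_biUnion.2 ⟨y', hy', hzy'⟩) hzz
      have h2 := dist_triangle4 z u v z'
      rw [dist_comm z u] at h2
      rw [Metric.mem_ball] at hu hv'
      linarith
    · intro z hz u hu hud
      obtain ⟨x, hx, y, hyx, hy, hzy⟩ := hparent z hz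
      have hnw : ¬ wide y := by
        rintro ⟨w, hwy, hwd⟩
        have h1 : dist u y < η := hrsub y hy z hzy hu
        have h2 := dist_triangle4 u y w d
        rw [dist_comm y w] at h2
        linarith
      rw [hHn y hnw] at hzy
      have h1 := (hG1' y hy z hzy).2.trans_le (min_le_right _ _)
      have h2 := dist_triangle u z y
      rw [Metric.mem_ball] at hu
      exact ⟨y, hy, by linarith⟩
  · -- the compact set
    set KF : Finset X := hfin.toFinset.filter (fun t => t ∉ perfPart X) ∪ F' with hKF
    have hKmem : ∀ z, z ∈ KF ↔ (z ∈ (T : Set X) ∧ z ∉ perfPart X) ∨ z ∈ F' := by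
      intro z
      rw [hKF, Finset.mem_union, Finset.mem_filter, Set.Finite.mem_toFinset]
    have hHne : ∀ y ∈ AA, (H y).Nonempty := by
      intro y hy
      rw [← Finset.card_pos, hHc y hy]
      omega
    have hnear : ∀ t ∈ (T : Set X), ∃ z ∈ (KF : Set X), dist t z ≤ ε / 2 := by
      intro t ht
      by_cases htp : t ∈ perfPart X
      · rcases hT.1 ht with h | h
        · exact (not_iso_of_perf htp h).elim
        · obtain ⟨x, hx, htx⟩ := Set.mem_iUnion₂.1 h
          have htA := hmemAA x hx t (hA1 x hx t ht htx)
          obtain ⟨z, hz⟩ := hHne t htA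
          refine ⟨z, (hKmem z).2 (Or.inr (Finset.mem_biUnion.2 ⟨t, htA, hz⟩)), ?_⟩
          have := (hHD t htA z hz).2
          rw [dist_comm]
          linarith
      · exact ⟨t, (hKmem t).2 (Or.inl ⟨ht, htp⟩), by rw [dist_self]; linarith⟩
    have hKne : (KF : Set X).Nonempty := by
      obtain ⟨t, ht⟩ := T.nonempty
      obtain ⟨z, hz, _⟩ := hnear t ht
      exact ⟨z, hz⟩
    refine ⟨⟨⟨(KF : Set X), KF.finite_toSet.isCompact⟩, hKne⟩, ⟨?_, ?_⟩, ?_⟩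
    · intro z hz
      rcases (hKmem z).1 hz with ⟨h1, h2⟩ | h
      · rcases (hTD h1).2 with h | h
        · exact Or.inl h
        · exact (h2 h).elim
      · exact Or.inr (Set.mem_iUnion₂.2 ⟨z, h, Metric.mem_ball_self hr'⟩)
    · exact Set.mem_iInter₂.2 fun z hz =>
        ⟨z, (hKmem z).2 (Or.inr hz), Metric.mem_ball_self hr'⟩
    · rw [Metric.NonemptyCompacts.dist_eq]
      refine lt_of_le_of_lt (Metric.hausdorffDist_le_of_mem_dist (r := ε / 2) (by linarith)
        ?_ hnear) (by linarith)
      intro z hz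
      rcases (hKmem z).1 hz with ⟨h1, h2⟩ | h
      · exact ⟨z, h1, by rw [dist_self]; linarith⟩
      · obtain ⟨x, hx, y, hyx, hy, hzy⟩ := hparent z h
        obtain ⟨_, _, t, ht, hyt⟩ := hA2 x hx y hyx
        refine ⟨t, ht, ?_⟩
        have h1 := (hHD y hy z hzy).2
        have h2 := dist_triangle z y t
        linarith

end density

section generic

variable {X : Type*} [MetricSpace X]

lemma residual_imp {Y : Type*} [TopologicalSpace Y] {U V : Set Y} (hV : IsOpen V)
    (h : U ⊆ closure V) : ∀ᶠ y in residual Y, y ∈ U → y ∈ V := by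
  have h1 : V ∪ (closure V)ᶜ ∈ residual Y := by
    refine residual_of_dense_open (hV.union isClosed_closure.isOpen_compl) ?_
    intro y
    by_cases hy : y ∈ closure V
    · exact closure_mono subset_union_left hy
    · exact subset_closure (Or.inr hy)
  filter_upwards [h1] with y hy hU
  rcases hy with h' | h'
  · exact h'
  · exact (h' (h hU)).elim

lemma exists_finite_mem {D : Set X} (hD : Dense D) {O : Set (NonemptyCompacts X)} (hO : IsOpen O)
    (hne : O.Nonempty) : ∃ T ∈ O, (T : Set X).Finite ∧
      (T : Set X) ⊆ D ∩ (isoPts X ∪ perfPart X) := by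
  obtain ⟨K, hK⟩ := hne
  have h := NonemptyCompacts.closure_finite_subsets (D ∩ (isoPts X ∪ perfPart X))
  have hKc : K ∈ closure {K : NonemptyCompacts X | (K : Set X).Finite ∧
      (K : Set X) ⊆ D ∩ (isoPts X ∪ perfPart X)} := by
    rw [h]
    intro x _
    exact dense_D0 hD x
  obtain ⟨T, hTO, hT⟩ := mem_closure_iff.1 hKc O hO hK
  exact ⟨T, hTO, hT⟩

lemma generic_initial {D : Set X} (hD : Dense D) :
    ∀ᶠ K in residual (NonemptyCompacts X), ∃ F : Finset X, ∃ r : ℝ, Valid D F r ∧ K ∈ Nbd F r := by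
  have hV : IsOpen {K : NonemptyCompacts X | ∃ F : Finset X, ∃ r : ℝ,
      Valid D F r ∧ K ∈ Nbd F r} := by
    rw [isOpen_iff_mem_nhds]
    rintro K ⟨F, r, hv, hK⟩
    filter_upwards [(isOpen_Nbd F r).mem_nhds hK] with K' hK'
    exact ⟨F, r, hv, hK'⟩
  refine (residual_imp (U := Set.univ) hV ?_).mono fun K h => h (Set.mem_univ K)
  intro K _
  rw [mem_closure_iff]
  intro O hO hKO
  obtain ⟨T, hTO, hfin, hTD⟩ := exists_finite_mem hD hO ⟨K, hKO⟩
  exact ⟨T, hTO, exists_initial T hfin hTD⟩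

lemma generic_step {D : Set X} (hD : Dense D) {F : Finset X} {r : ℝ} (hv : Valid D F r)
    (hne : F.Nonempty) (d : X) {q : ℝ} (hq : 0 < q) (n : ℕ) :
    ∀ᶠ K in residual (NonemptyCompacts X), K ∈ Nbd F r → ∃ F' : Finset X, ∃ r' : ℝ,
      (Valid D F' r' ∧ Refine F r F' r' ∧ WCond F' r' d q n) ∧ K ∈ Nbd F' r' := by
  have hV : IsOpen {K : NonemptyCompacts X | ∃ F' : Finset X, ∃ r' : ℝ,
      (Valid D F' r' ∧ Refine F r F' r' ∧ WCond F' r' d q n) ∧ K ∈ Nbd F' r'} := by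
    rw [isOpen_iff_mem_nhds]
    rintro K ⟨F', r', hv', hK⟩
    filter_upwards [(isOpen_Nbd F' r').mem_nhds hK] with K' hK'
    exact ⟨F', r', hv', hK'⟩
  refine (residual_imp (U := Nbd F r) hV ?_).mono fun K h hK => h hK
  intro K hK
  rw [mem_closure_iff]
  intro O hO hKO
  obtain ⟨T, ⟨hTO, hTN⟩, hfin, hTD⟩ :=
    exists_finite_mem hD (hO.inter (isOpen_Nbd F r)) ⟨K, hKO, hK⟩
  obtain ⟨ε, hε, hball⟩ := Metric.isOpen_iff.1 hO T hTO
  obtain ⟨F', r', h1, h2, h3, K', hK', hd⟩ := exists_step hD T hfin hTD hv hne hTN hε d hq n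
  exact ⟨K', hball hd, F', r', ⟨h1, h2, h3⟩, hK'⟩

lemma generic_all {D : Set X} (hDc : D.Countable) (hD : Dense D) :
    ∀ᶠ K in residual (NonemptyCompacts X), ∀ F : Finset X, ∀ r : ℝ, ∀ d ∈ D, ∀ k n : ℕ,
      Valid D F r → F.Nonempty → K ∈ Nbd F r → ∃ F' : Finset X, ∃ r' : ℝ,
      (Valid D F' r' ∧ Refine F r F' r' ∧ WCond F' r' d (1 / ((k : ℝ) + 1)) n) ∧
        K ∈ Nbd F' r' := by
  classical
  have : Countable D := hDc.to_subtype
  have key : ∀ᶠ K in residual (NonemptyCompacts X), ∀ F : Finset D, ∀ j : ℕ, ∀ d : D, ∀ k n : ℕ,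
      Valid D (F.map (Function.Embedding.subtype _)) (1 / ((j : ℝ) + 1)) →
      (F.map (Function.Embedding.subtype _)).Nonempty →
      K ∈ Nbd (F.map (Function.Embedding.subtype _)) (1 / ((j : ℝ) + 1)) →
      ∃ F' : Finset X, ∃ r' : ℝ,
      (Valid D F' r' ∧ Refine (F.map (Function.Embedding.subtype _)) (1 / ((j : ℝ) + 1)) F' r' ∧
        WCond F' r' d (1 / ((k : ℝ) + 1)) n) ∧ K ∈ Nbd F' r' := by
    simp only [eventually_countable_forall]
    intro F j d k n hv hne
    exact generic_step hD hv hne d (Nat.one_div_pos_of_nat (α := ℝ) (n := k)) n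
  filter_upwards [key] with K hK F r d hd k n hv hne hKN
  obtain ⟨j, rfl⟩ := hv.rad
  have hF : (F.subtype (· ∈ D)).map (Function.Embedding.subtype _) = F :=
    Finset.subtype_map_of_mem fun x hx => hv.subD hx
  have := hK (F.subtype (· ∈ D)) j ⟨d, hd⟩ k n
  rw [hF] at this
  exact this hv hne hKN

lemma refine_nonempty {F F' : Finset X} {r r' : ℝ} (h : Refine F r F' r') (hne : F.Nonempty) :
    F'.Nonempty := by
  obtain ⟨x, hx⟩ := hne
  obtain ⟨a, ha, hc⟩ := h.count
  have h1 : ((F' : Set X) ∩ Metric.ball x r).Nonempty := by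
    apply Set.nonempty_of_ncard_ne_zero
    rw [hc x hx]; omega
  obtain ⟨z, hz, _⟩ := h1
  exact ⟨z, hz⟩

/-- A state of the chain construction. -/
def Good (D : Set X) (K : NonemptyCompacts X) (S : Finset X × ℝ) : Prop :=
  Valid D S.1 S.2 ∧ S.1.Nonempty ∧ K ∈ Nbd S.1 S.2

lemma exists_chain {D : Set X} (hDc : D.Countable) (hDne : D.Nonempty) {K : NonemptyCompacts X}
    (hK : ∀ F : Finset X, ∀ r : ℝ, ∀ d ∈ D, ∀ k n : ℕ,
      Valid D F r → F.Nonempty → K ∈ Nbd F r → ∃ F' : Finset X, ∃ r' : ℝ,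
      (Valid D F' r' ∧ Refine F r F' r' ∧ WCond F' r' d (1 / ((k : ℝ) + 1)) n) ∧
        K ∈ Nbd F' r') {F0 : Finset X} {r0 : ℝ} (hv : Valid D F0 r0) (hne : F0.Nonempty)
    (hK0 : K ∈ Nbd F0 r0) :
    ∃ F : ℕ → Finset X, ∃ r : ℕ → ℝ, GChain F r ((K : Set X) \ isoPts X) ∧
      ∀ d ∈ D, ∀ k : ℕ, ∀ n0, ∃ n ≥ n0,
        WCond (F (n + 1)) (r (n + 1)) d (1 / ((k : ℝ) + 1)) n := by
  have : Countable D := hDc.to_subtype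
  have : Nonempty D := hDne.to_subtype
  obtain ⟨e, he⟩ := exists_surjective_nat (D × ℕ)
  have step : ∀ (n : ℕ) (S : {S : Finset X × ℝ // Good D K S}),
      ∃ S' : {S : Finset X × ℝ // Good D K S}, Refine S.1.1 S.1.2 S'.1.1 S'.1.2 ∧
        WCond S'.1.1 S'.1.2 ((e n.unpair.1).1 : X) (1 / (((e n.unpair.1).2 : ℝ) + 1)) n := by
    rintro n ⟨⟨F, r⟩, hv, hne, hKN⟩
    obtain ⟨F', r', ⟨h1, h2, h3⟩, h4⟩ := hK F r (e n.unpair.1).1 (e n.unpair.1).1.2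
      (e n.unpair.1).2 n hv hne hKN
    exact ⟨⟨(F', r'), h1, refine_nonempty h2 hne, h4⟩, h2, h3⟩
  choose next hnext1 hnext2 using step
  let S : ℕ → {S : Finset X × ℝ // Good D K S} :=
    fun n => Nat.rec ⟨(F0, r0), hv, hne, hK0⟩ (fun n s => next n s) n
  have hS : ∀ n, S (n + 1) = next n (S n) := fun n => rfl
  refine ⟨fun n => (S n).1.1, fun n => (S n).1.2, ⟨fun n => (S n).2.1.pos, fun n => ?_,
    fun n => (S n).2.1.sep, fun n => ?_, fun n => ?_, (S 0).2.2.1, ?_, ?_⟩, ?_⟩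
  · simp only [hS]; exact (hnext1 n (S n)).half
  · simp only [hS]; exact (hnext1 n (S n)).nest
  · simp only [hS]; exact (hnext1 n (S n)).count
  · rintro n p ⟨hp, hpi⟩
    rcases (S n).2.2.2.1 hp with h | h
    · exact (hpi h).elim
    · obtain ⟨x, hx, h⟩ := Set.mem_iUnion₂.1 h
      exact ⟨x, hx, h⟩
  · intro n x hx
    obtain ⟨p, hp, hpx⟩ := Set.mem_iInter₂.1 (S n).2.2.2.2 x hx
    exact ⟨p, ⟨hp, not_iso_of_perf ((S n).2.1.perf x hx hpx)⟩, hpx⟩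
  · intro d hd k n0
    obtain ⟨i, hi⟩ := he (⟨d, hd⟩, k)
    refine ⟨Nat.pair i n0, Nat.right_le_pair i n0, ?_⟩
    have := hnext2 (Nat.pair i n0) (S (Nat.pair i n0))
    rw [Nat.unpair_pair, hi] at this
    simp only [hS]
    exact this

lemma iso_finite {K Q : Set X} (hK : IsCompact K) (hQ : IsOpen Q) (h : K ⊆ isoPts X ∪ Q) :
    (K \ Q).Finite := by
  have hc : IsCompact (K \ Q) := hK.diff hQ
  obtain ⟨J, hJ⟩ := hc.elim_finite_subcover (fun x : isoPts X => ({(x : X)} : Set X))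
    (fun x => x.2) (by
      rintro p ⟨hp, hpQ⟩
      rcases h hp with h | h
      · exact Set.mem_iUnion.2 ⟨⟨p, h⟩, rfl⟩
      · exact (hpQ h).elim)
  exact (J.finite_toSet.biUnion fun x _ => Set.finite_singleton _).subset hJ

end generic

/-- Main Theorem: in a Polish space, the generic non-empty compact set `K` is either finite
or there is a continuous gauge function `h` with `0 < ℋ^h(K) < ∞` such that
`ℋ^h(K ∩ f(K)) = 0` for every weak contraction `f : K → X`. -/
theorem generic_compact_main_theorem
    {X : Type*} [MetricSpace X] [CompleteSpace X] [SeparableSpace X]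
    [MeasurableSpace X] [BorelSpace X] :
    {K : NonemptyCompacts X | (K : Set X).Finite ∨
        ∃ h : ENNReal → ENNReal, IsContinuousGauge h ∧
          0 < Measure.mkMetric h (K : Set X) ∧ Measure.mkMetric h (K : Set X) < ⊤ ∧
          ∀ f : X → X,
            (∀ x ∈ (K : Set X), ∀ y ∈ (K : Set X), x ≠ y → dist (f x) (f y) < dist x y) →
            Measure.mkMetric h ((K : Set X) ∩ f '' (K : Set X)) = 0} ∈
      residual (NonemptyCompacts X) := by
  obtain ⟨D, hDc, hD⟩ := TopologicalSpace.exists_countable_dense X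
  filter_upwards [generic_initial hD, generic_all hDc hD] with K hK0 hK
  obtain ⟨F0, r0, hv, hKN⟩ := hK0
  rcases F0.eq_empty_or_nonempty with he | hne
  · left
    have h1 : (K : Set X) ⊆ isoPts X ∪ ∅ := by
      have := hKN.1
      subst he
      simpa using this
    have := iso_finite K.isCompact isOpen_empty h1
    simpa using this
  · right
    have hDne : D.Nonempty := by
      obtain ⟨x, hx⟩ := hne
      exact ⟨x, hv.subD hx⟩
    obtain ⟨F, r, c, hw⟩ := exists_chain hDc hDne hK hv hne hKN
    have hQ : IsCompact ((K : Set X) \ isoPts X) := K.isCompact.diff isOpen_isoPts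
    have hI : ((K : Set X) ∩ isoPts X).Finite := by
      refine (iso_finite K.isCompact (isOpen_biUnion fun x _ => Metric.isOpen_ball)
        hKN.1).subset ?_
      rintro p ⟨hp, hpi⟩
      refine ⟨hp, fun h => ?_⟩
      obtain ⟨x, hx, hpx⟩ := Set.mem_iUnion₂.1 h
      exact not_iso_of_perf (hv.perf x hx hpx) hpi
    have hsplit : (K : Set X) = ((K : Set X) \ isoPts X) ∪ ((K : Set X) ∩ isoPts X) :=
      (Set.sdiff_union_inter _ _).symm
    have hI0 : Measure.mkMetric (GChain.gauge F r) ((K : Set X) ∩ isoPts X) = 0 :=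
      GChain.null_countable hI.countable
    refine ⟨GChain.gauge F r,
      theGauge_isContinuousGauge c.pos c.lim c.card_pos c.card_double, ?_, ?_, ?_⟩
    · exact (c.lower hQ).trans_le (measure_mono sdiff_subset)
    · rw [hsplit]
      refine (measure_union_le _ _).trans_lt ?_
      rw [hI0, add_zero]
      exact c.upper
    · intro f hf
      have h0 := c.null_contraction hDc hD hw f
        (fun x hx y hy hxy => hf x hx.1 y hy.1 hxy)
      have hfI : Measure.mkMetric (GChain.gauge F r) (f '' ((K : Set X) ∩ isoPts X)) = 0 :=
        GChain.null_countable (hI.image f).countable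
      refine measure_mono_null ?_ (measure_union_null h0 (measure_union_null hI0 hfI))
      rintro p ⟨hp, u, hu, rfl⟩
      by_cases hui : u ∈ isoPts X
      · exact Or.inr (Or.inr ⟨u, ⟨hu, hui⟩, rfl⟩)
      · by_cases hpi : f u ∈ isoPts X
        · exact Or.inr (Or.inl ⟨hp, hpi⟩)
        · exact Or.inl ⟨⟨hp, hpi⟩, u, ⟨hu, hui⟩, rfl⟩
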